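/- Let C be a real symmetric d×d matrix with eigenvalues λ_0 ≥ λ_1 ≥ … ≥ λ_{d−1} (listed with multiplicity), orthonormal eigenvectors v_0, …, v_{d−1}, and suppose λ_{k−1} > λ_k for some k with 1 ≤ k < d. If m_1, …, m_k is an orthonormal family in ℝ^d achieving Σ_{i=1}^{k} ⟨C m_i, m_i⟩ = Σ_{z=0}^{k−1} λ_z, then the linear span of {m_1, …, m_k} equals the linear span of {v_0, …, v_{k−1}}; that is, the optimal k-dimensional subspace for capturing the directional derivatives of the loss is spanned by the top-k eigenvectors. -/

import Mathlib

open Matrix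

/-- A family of real vectors is dot-product orthonormal iff its image in Euclidean space is. -/
theorem orthonormal_toLp_of_dotProduct {ι n : Type*} [DecidableEq ι] [Fintype n]
    {M : ι → n → ℝ} (hM : ∀ i j, M i ⬝ᵥ M j = if i = j then 1 else 0) :
    Orthonormal ℝ (fun i => WithLp.toLp 2 (M i)) := by
  rw [orthonormal_iff_ite]
  intro i j
  rw [EuclideanSpace.inner_toLp_toLp, star_trivial, dotProduct_comm, hM]

theorem linearIndependent_of_dotProduct {ι n : Type*} [DecidableEq ι] [Fintype n]
    {M : ι → n → ℝ} (hM : ∀ i j, M i ⬝ᵥ M j = if i = j then 1 else 0) :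
    LinearIndependent ℝ M :=
  LinearIndependent.of_comp (WithLp.linearEquiv 2 ℝ (n → ℝ)).symm.toLinearMap
    (orthonormal_toLp_of_dotProduct hM).linearIndependent

/-- Bessel's inequality for the dot product. -/
theorem sum_sq_dotProduct_le {ι n : Type*} [DecidableEq ι] [Fintype ι] [Fintype n]
    {M : ι → n → ℝ} (hM : ∀ i j, M i ⬝ᵥ M j = if i = j then 1 else 0) (x : n → ℝ) :
    ∑ i, (x ⬝ᵥ M i) ^ 2 ≤ x ⬝ᵥ x := by
  have h := (orthonormal_toLp_of_dotProduct hM).sum_inner_products_le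
    (x := WithLp.toLp 2 x) (s := Finset.univ)
  simpa only [← real_inner_self_eq_norm_sq, EuclideanSpace.inner_toLp_toLp, star_trivial,
    Real.norm_eq_abs, sq_abs] using h

/-- Expansion of a vector in an orthonormal basis. -/
theorem sum_dotProduct_smul_eq {n : Type*} [DecidableEq n] [Fintype n]
    {v : n → n → ℝ} (hv : ∀ i j, v i ⬝ᵥ v j = if i = j then 1 else 0) (x : n → ℝ) :
    ∑ z, (v z ⬝ᵥ x) • v z = x := by
  have h : of v * (of v)ᵀ = 1 := by
    ext i j
    rw [one_apply, ← hv i j]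
    rfl
  calc ∑ z, (v z ⬝ᵥ x) • v z = (of v)ᵀ *ᵥ (of v *ᵥ x) := by
        rw [mulVec_transpose, vecMul_eq_sum]
        rfl
    _ = x := by rw [mulVec_mulVec, mul_eq_one_comm.mp h, one_mulVec]

/-- A symmetric form is diagonal in an orthonormal eigenbasis. -/
theorem mulVec_dotProduct_self_eq_sum {n : Type*} [DecidableEq n] [Fintype n]
    {C : Matrix n n ℝ} {lam : n → ℝ} {v : n → n → ℝ}
    (hv : ∀ i j, v i ⬝ᵥ v j = if i = j then 1 else 0)
    (hC : ∀ z, C *ᵥ v z = lam z • v z) (x : n → ℝ) :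
    (C *ᵥ x) ⬝ᵥ x = ∑ z, lam z * (v z ⬝ᵥ x) ^ 2 := by
  have h : C *ᵥ x = ∑ z, (v z ⬝ᵥ x) • lam z • v z := by
    conv_lhs => rw [← sum_dotProduct_smul_eq hv x]
    simp only [mulVec_sum, mulVec_smul, hC]
  rw [h, sum_dotProduct]
  refine Finset.sum_congr rfl fun z _ => ?_
  simp only [smul_dotProduct, smul_eq_mul]
  ring

theorem dotProduct_self_eq_sum_sq {n : Type*} [DecidableEq n] [Fintype n]
    {v : n → n → ℝ} (hv : ∀ i j, v i ⬝ᵥ v j = if i = j then 1 else 0) (x : n → ℝ) :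
    x ⬝ᵥ x = ∑ z, (v z ⬝ᵥ x) ^ 2 := by
  simpa using mulVec_dotProduct_self_eq_sum (C := 1) (lam := 1) hv (by simp) x

theorem sum_castLE_eq_sum_ite {d k : ℕ} (hkd : k ≤ d) (f : Fin d → ℝ) :
    ∑ z : Fin k, f (Fin.castLE hkd z) = ∑ z : Fin d, f z * if (z : ℕ) < k then 1 else 0 := by
  obtain ⟨m, rfl⟩ := Nat.exists_eq_add_of_le hkd
  rw [Fin.sum_univ_add]
  simp only [mul_ite, mul_one, mul_zero, Fin.val_castAdd, Fin.is_lt, if_true, Fin.val_natAdd]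
  simp
  rfl

/-- Uniqueness of the optimal subspace: if `C` is real symmetric with eigenvalues
`λ_0 ≥ … ≥ λ_{d-1}`, orthonormal eigenvectors `v_0, …, v_{d-1}`, and a spectral gap
`λ_{k-1} > λ_k` (`1 ≤ k < d`), then any orthonormal family `m_1, …, m_k` achieving
`Σ_i ⟨C m_i, m_i⟩ = Σ_{z<k} λ_z` spans the same subspace as the top-`k`
eigenvectors `v_0, …, v_{k-1}`. -/
theorem stmt_15 {d k : ℕ} (hk1 : 1 ≤ k) (hkd : k < d)
    (C : Matrix (Fin d) (Fin d) ℝ) (hC : C.IsSymm)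
    (lam : Fin d → ℝ) (hmono : ∀ i j : Fin d, i ≤ j → lam j ≤ lam i)
    (hgap : lam ⟨k, hkd⟩ < lam ⟨k - 1, by omega⟩)
    (v : Fin d → (Fin d → ℝ))
    (hv_on : ∀ i j : Fin d, v i ⬝ᵥ v j = if i = j then 1 else 0)
    (hv_eig : ∀ z : Fin d, C *ᵥ v z = lam z • v z)
    (M : Fin k → (Fin d → ℝ))
    (hM_on : ∀ i j : Fin k, M i ⬝ᵥ M j = if i = j then 1 else 0)
    (hopt : ∑ i : Fin k, (C *ᵥ M i) ⬝ᵥ M i = ∑ z : Fin k, lam (Fin.castLE hkd.le z)) :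
    Submodule.span ℝ (Set.range M)
      = Submodule.span ℝ (Set.range (fun z : Fin k => v (Fin.castLE hkd.le z))) := by
  have hv_self (z) : v z ⬝ᵥ v z = 1 := by simp [hv_on]
  let a : Fin d → ℝ := fun z => ∑ i, (v z ⬝ᵥ M i) ^ 2
  let χ : Fin d → ℝ := fun z => if (z : ℕ) < k then 1 else 0
  let μ := lam ⟨k - 1, by omega⟩
  have ha0 (z) : 0 ≤ a z := Finset.sum_nonneg fun i _ => sq_nonneg _
  have ha1 (z) : a z ≤ 1 := (sum_sq_dotProduct_le hM_on (v z)).trans_eq (hv_self z)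
  have ha_sum : ∑ z, a z = ∑ z, χ z := by
    rw [Finset.sum_comm]
    simp only [← dotProduct_self_eq_sum_sq hv_on, hM_on, if_true]
    simpa [χ] using sum_castLE_eq_sum_ite hkd.le 1
  have ha_opt : ∑ z, lam z * a z = ∑ z, lam z * χ z := by
    rw [← sum_castLE_eq_sum_ite hkd.le lam, ← hopt]
    simp only [a, Finset.mul_sum, mulVec_dotProduct_self_eq_sum hv_on hv_eig]
    exact Finset.sum_comm
  have hlow (z : Fin d) (hz : k ≤ z) : lam z < μ := (hmono ⟨k, hkd⟩ z hz).trans_lt hgap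
  have hterm (z) : 0 ≤ (lam z - μ) * (χ z - a z) := by
    by_cases hz : (z : ℕ) < k
    · have hle : μ ≤ lam z := hmono z ⟨k - 1, by omega⟩ (Fin.mk_le_mk.mpr (by omega))
      simp only [χ, hz, if_true]
      exact mul_nonneg (sub_nonneg.mpr hle) (sub_nonneg.mpr (ha1 z))
    · simp only [χ, hz, if_false]
      exact mul_nonneg_of_nonpos_of_nonpos (sub_nonpos.mpr (hlow z (not_lt.mp hz)).le)
        (sub_nonpos.mpr (ha0 z))
  have hsum : ∑ z, (lam z - μ) * (χ z - a z) = 0 := by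
    simp only [sub_mul, mul_sub, Finset.sum_sub_distrib, ← Finset.mul_sum, ha_sum, ha_opt]
    ring
  have hzero := (Finset.sum_eq_zero_iff_of_nonneg fun z _ => hterm z).mp hsum
  have horth (z : Fin d) (hz : k ≤ z) (i) : v z ⬝ᵥ M i = 0 := by
    have haz : a z = 0 := by
      simpa [χ, not_lt.mpr hz, (sub_neg.mpr (hlow z hz)).ne] using hzero z (Finset.mem_univ z)
    exact pow_eq_zero_iff two_ne_zero |>.mp <|
      (Finset.sum_eq_zero_iff_of_nonneg fun i _ => sq_nonneg _).mp haz i (Finset.mem_univ i)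
  apply Submodule.eq_of_le_of_finrank_eq
  · rw [Submodule.span_le]
    rintro _ ⟨i, rfl⟩
    rw [← sum_dotProduct_smul_eq hv_on (M i)]
    refine Submodule.sum_mem _ fun z _ => ?_
    by_cases hz : (z : ℕ) < k
    · exact Submodule.smul_mem _ _ (Submodule.subset_span ⟨⟨z, hz⟩, rfl⟩)
    · simp [horth z (not_lt.mp hz) i]
  · rw [finrank_span_eq_card (linearIndependent_of_dotProduct hM_on)]
    exact (finrank_span_eq_card ((linearIndependent_of_dotProduct hv_on).comp _
      (Fin.castLE_injective hkd.le))).symm
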